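/- Let S be a real n×k matrix with SᵀS = I_k, let P = SSᵀ, and let V be a real n×k matrix with VᵀS + SᵀV = 0. Define X = VSᵀ − SVᵀ + 2SVᵀSSᵀ and Ω = SᵀV. Then Xᵀ = −X, XP + PX = X, Ωᵀ = −Ω, and XS + SΩ = V. -/

import Mathlib

open Matrix

/-- For `S` with `SᵀS = I_k`, `P = SSᵀ`, and a tangent vector `V`
(`VᵀS + SᵀV = 0`), the matrices `X = VSᵀ − SVᵀ + 2SVᵀSSᵀ` and `Ω = SᵀV` satisfy
`Xᵀ = −X`, `XP + PX = X`, `Ωᵀ = −Ω`, and `XS + SΩ = V`. -/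
theorem stiefel_tangent_decomposition {n k : ℕ}
    (S : Matrix (Fin n) (Fin k) ℝ) (hS : Sᵀ * S = 1)
    (V : Matrix (Fin n) (Fin k) ℝ) (hV : Vᵀ * S + Sᵀ * V = 0) :
    (V * Sᵀ - S * Vᵀ + (2 : ℝ) • (S * Vᵀ * S * Sᵀ))ᵀ
        = -(V * Sᵀ - S * Vᵀ + (2 : ℝ) • (S * Vᵀ * S * Sᵀ)) ∧
      (V * Sᵀ - S * Vᵀ + (2 : ℝ) • (S * Vᵀ * S * Sᵀ)) * (S * Sᵀ)
          + (S * Sᵀ) * (V * Sᵀ - S * Vᵀ + (2 : ℝ) • (S * Vᵀ * S * Sᵀ))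
        = V * Sᵀ - S * Vᵀ + (2 : ℝ) • (S * Vᵀ * S * Sᵀ) ∧
      (Sᵀ * V)ᵀ = -(Sᵀ * V) ∧
      (V * Sᵀ - S * Vᵀ + (2 : ℝ) • (S * Vᵀ * S * Sᵀ)) * S + S * (Sᵀ * V) = V := by
  have h1 : Sᵀ * V = -(Vᵀ * S) := by
    rw [eq_neg_iff_add_eq_zero, add_comm]; exact hV
  have h2 : ∀ {m : ℕ} (A : Matrix (Fin k) (Fin m) ℝ),
      Sᵀ * (V * A) = -(Vᵀ * (S * A)) := by
    intro m A
    rw [← Matrix.mul_assoc, h1, Matrix.neg_mul, Matrix.mul_assoc]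
  have h3 : ∀ {m : ℕ} (A : Matrix (Fin k) (Fin m) ℝ), Sᵀ * (S * A) = A := by
    intro m A
    rw [← Matrix.mul_assoc, hS, Matrix.one_mul]
  refine ⟨?_, ?_, ?_, ?_⟩
  · simp only [Matrix.transpose_add, Matrix.transpose_sub, Matrix.transpose_smul,
      Matrix.transpose_mul, Matrix.transpose_transpose, Matrix.mul_assoc, h2, Matrix.mul_neg]
    module
  · simp only [Matrix.add_mul, Matrix.sub_mul, Matrix.mul_add, Matrix.mul_sub, Matrix.smul_mul,
      Matrix.mul_smul, Matrix.mul_assoc, h2, h3, Matrix.mul_neg]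
    module
  · rw [Matrix.transpose_mul, Matrix.transpose_transpose, h1, neg_neg]
  · simp only [Matrix.add_mul, Matrix.sub_mul, Matrix.smul_mul,
      Matrix.mul_assoc, h1, hS, Matrix.mul_neg, Matrix.mul_one]
    module
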